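/- arXiv:0911.0074 — 2 statements merged into one kernel-verified Lean document; each statement's English description precedes it below -/
import Mathlib

section
/- For every τ > 0 and every x in the linear span of the Haar system {h_I : I ∈ 𝒟}, the set {J ∈ 𝒟 : |⟨x, h_J⟩| ≥ τ} has cardinality at most 16 τ^{−2} ‖x‖²_{H¹}, where ⟨·,·⟩ is the L² inner product on [0,1). -/
open MeasureTheory
open scoped ENNReal

noncomputable section

namespace DyadicH

/-- The index `q = (n, k)` encodes the dyadic interval `[k/2^n, (k+1)/2^n)`; it is a genuine
dyadic subinterval of `[0,1)` iff `k < 2^n`. -/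
def IsDyadic (q : ℕ × ℕ) : Prop := q.2 < 2 ^ q.1

/-- The dyadic interval `[k/2^n, (k+1)/2^n)` associated to the index `q = (n, k)`. -/
def dint (q : ℕ × ℕ) : Set ℝ := Set.Ico ((q.2 : ℝ) / 2 ^ q.1) ((q.2 + 1 : ℝ) / 2 ^ q.1)

/-- The length `|I| = 2^{-n}` of the dyadic interval indexed by `q = (n, k)`. -/
def len (q : ℕ × ℕ) : ℝ := ((2 : ℝ) ^ q.1)⁻¹

/-- The `L^∞`-normalized Haar function `h_I`: `+1` on the left half of `I`, `-1` on the right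
half of `I`, `0` outside `I`. -/
def haarFn (q : ℕ × ℕ) : ℝ → ℝ :=
  (Set.Ico ((q.2 : ℝ) / 2 ^ q.1) ((2 * q.2 + 1 : ℝ) / 2 ^ (q.1 + 1))).indicator
      (fun _ => (1 : ℝ))
    - (Set.Ico ((2 * q.2 + 1 : ℝ) / 2 ^ (q.1 + 1)) ((q.2 + 1 : ℝ) / 2 ^ q.1)).indicator
      (fun _ => (1 : ℝ))

/-- The `L²` inner product on `[0,1)`. -/
def ip (f g : ℝ → ℝ) : ℝ := ∫ t in Set.Ico (0 : ℝ) 1, f t * g t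

/-- The Haar coefficient `⟨f, h_I⟩`. -/
def haarCoeff (f : ℝ → ℝ) (q : ℕ × ℕ) : ℝ := ip f (haarFn q)

/-- The type of (indices of) dyadic intervals. -/
def Didx : Type := {q : ℕ × ℕ // IsDyadic q}

/-- The dyadic square function `S(f) = (∑_{I ∈ 𝒟} ⟨f, h_I/|I|⟩² 1_I)^{1/2}`. -/
def sqFn (f : ℝ → ℝ) : ℝ → ℝ := fun t =>
  Real.sqrt (∑' q : Didx,
    (haarCoeff f q.1 * 2 ^ q.1.1) ^ 2 * (dint q.1).indicator (fun _ => (1 : ℝ)) t)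

/-- The dyadic `H¹` norm `‖f‖_{H¹} = ‖S(f)‖_{L¹}`. -/
def H1norm (f : ℝ → ℝ) : ℝ := ∫ t in Set.Ico (0 : ℝ) 1, sqFn f t

/-- The linear span of the Haar system `{h_I : I ∈ 𝒟}`. -/
def haarSpan : Submodule ℝ (ℝ → ℝ) := Submodule.span ℝ (haarFn '' {q | IsDyadic q})

/-- The linear span of `{h_I : I ∈ 𝒟_N}`. -/
def haarSpanLe (N : ℕ) : Submodule ℝ (ℝ → ℝ) :=
  Submodule.span ℝ (haarFn '' {q | IsDyadic q ∧ q.1 ≤ N})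

/-- `𝒟_m = {I ∈ 𝒟 : |I| ≥ 2^{-m}}` as a finite set of indices. -/
def dFinset (m : ℕ) : Finset (ℕ × ℕ) :=
  (Finset.range (m + 1)).biUnion fun n => (Finset.range (2 ^ n)).image fun k => (n, k)

open scoped Classical in
/-- The Carleson constant `⟦G⟧ = sup_{I ∈ G} |I|⁻¹ ∑_{J ∈ G, J ⊆ I} |J|` of a finite
collection of dyadic intervals. -/
def carleson (G : Finset (ℕ × ℕ)) : ℝ :=
  ⨆ I ∈ G, ((2 : ℝ) ^ I.1 * ∑ J ∈ G, if dint J ⊆ dint I then len J else 0)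

end DyadicH

namespace DyadicH

lemma div_two_pow_le_iff_of_floor_eq {m n : ℕ} (hmn : m ≤ n) {t s : ℝ}
    (h : ⌊t * 2 ^ n⌋ = ⌊s * 2 ^ n⌋) (a : ℤ) :
    (a : ℝ) / 2 ^ m ≤ t ↔ (a : ℝ) / 2 ^ m ≤ s := by
  have key (u : ℝ) : (a : ℝ) / 2 ^ m ≤ u ↔ a * 2 ^ (n - m) ≤ ⌊u * 2 ^ n⌋ := by
    rw [Int.le_floor, div_le_iff₀ (by positivity)]
    push_cast
    have h2 : (2 : ℝ) ^ n = 2 ^ m * 2 ^ (n - m) := by rw [← pow_add, Nat.add_sub_cancel' hmn]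
    rw [h2, ← mul_assoc]
    exact (mul_le_mul_iff_of_pos_right (by positivity)).symm
  rw [key, key, h]

lemma haarFn_eq_of_floor_eq (q : ℕ × ℕ) {n : ℕ} (hn : q.1 + 1 ≤ n) {t s : ℝ}
    (h : ⌊t * 2 ^ n⌋ = ⌊s * 2 ^ n⌋) : haarFn q t = haarFn q s := by
  have h1 := div_two_pow_le_iff_of_floor_eq (m := q.1) (by lia) h q.2
  have h2 := div_two_pow_le_iff_of_floor_eq hn h (2 * q.2 + 1)
  have h3 := div_two_pow_le_iff_of_floor_eq (m := q.1) (by lia) h (q.2 + 1)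
  push_cast at h1 h2 h3
  simp only [haarFn, Pi.sub_apply, Set.indicator_apply, Set.mem_Ico, ← not_le, h1, h2, h3]

/-- A function in the Haar span is constant on all sufficiently short dyadic intervals. -/
lemma exists_eq_of_floor_eq {x : ℝ → ℝ} (hx : x ∈ haarSpan) :
    ∃ N : ℕ, ∀ n, N ≤ n → ∀ t s : ℝ, ⌊t * 2 ^ n⌋ = ⌊s * 2 ^ n⌋ → x t = x s := by
  induction hx using Submodule.span_induction with
  | mem x hx =>
    obtain ⟨q, -, rfl⟩ := hx
    exact ⟨q.1 + 1, fun n hn t s h => haarFn_eq_of_floor_eq q hn h⟩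
  | zero => exact ⟨0, fun _ _ _ _ _ => rfl⟩
  | add x y _ _ hx hy =>
    obtain ⟨N, hN⟩ := hx
    obtain ⟨M, hM⟩ := hy
    refine ⟨max N M, fun n hn t s h => ?_⟩
    simp only [Pi.add_apply, hN n (by lia) t s h, hM n (by lia) t s h]
  | smul a x _ hx =>
    obtain ⟨N, hN⟩ := hx
    exact ⟨N, fun n hn t s h => by simp only [Pi.smul_apply, hN n hn t s h]⟩

lemma floor_eq_of_mem_dint {q : ℕ × ℕ} {t : ℝ} (ht : t ∈ dint q) : ⌊t * 2 ^ q.1⌋ = q.2 := by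
  obtain ⟨h1, h2⟩ := ht
  rw [div_le_iff₀ (by positivity)] at h1
  rw [lt_div_iff₀ (by positivity)] at h2
  rw [Int.floor_eq_iff]
  exact ⟨by exact_mod_cast h1, by exact_mod_cast h2⟩

lemma dint_subset {q : ℕ × ℕ} (hq : IsDyadic q) : dint q ⊆ Set.Ico 0 1 := by
  refine Set.Ico_subset_Ico (by positivity) ?_
  rw [div_le_one (by positivity)]
  exact_mod_cast Nat.succ_le_of_lt hq

lemma left_le_mid (q : ℕ × ℕ) : (q.2 : ℝ) / 2 ^ q.1 ≤ (2 * q.2 + 1 : ℝ) / 2 ^ (q.1 + 1) := by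
  rw [div_le_div_iff₀ (by positivity) (by positivity), pow_succ]
  nlinarith [pow_pos (two_pos (α := ℝ)) q.1]

lemma mid_le_right (q : ℕ × ℕ) :
    (2 * q.2 + 1 : ℝ) / 2 ^ (q.1 + 1) ≤ (q.2 + 1 : ℝ) / 2 ^ q.1 := by
  rw [div_le_div_iff₀ (by positivity) (by positivity), pow_succ]
  nlinarith [pow_pos (two_pos (α := ℝ)) q.1]

lemma haarFn_eq_zero {q : ℕ × ℕ} {t : ℝ} (ht : t ∉ dint q) : haarFn q t = 0 := by
  have h1 := Set.notMem_subset (Set.Ico_subset_Ico_right (mid_le_right q)) ht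
  have h2 := Set.notMem_subset (Set.Ico_subset_Ico_left (left_le_mid q)) ht
  simp [haarFn, Set.indicator_of_notMem h1, Set.indicator_of_notMem h2]

lemma setIntegral_indicator_Ico {a b : ℝ} (hab : a ≤ b) (h : Set.Ico a b ⊆ Set.Ico 0 1) :
    ∫ t in Set.Ico (0 : ℝ) 1, (Set.Ico a b).indicator (fun _ => (1 : ℝ)) t = b - a := by
  rw [setIntegral_indicator measurableSet_Ico, Set.inter_eq_right.mpr h]
  simp [hab]

lemma integrableOn_indicator_Ico (a b : ℝ) :
    IntegrableOn ((Set.Ico a b).indicator fun _ => (1 : ℝ)) (Set.Ico 0 1) :=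
  (integrableOn_const (by simp)).indicator measurableSet_Ico

lemma setIntegral_haarFn {q : ℕ × ℕ} (hq : IsDyadic q) :
    ∫ t in Set.Ico (0 : ℝ) 1, haarFn q t = 0 := by
  simp only [haarFn, Pi.sub_apply]
  rw [integral_sub (integrableOn_indicator_Ico _ _) (integrableOn_indicator_Ico _ _),
    setIntegral_indicator_Ico (left_le_mid q)
      ((Set.Ico_subset_Ico_right (mid_le_right q)).trans (dint_subset hq)),
    setIntegral_indicator_Ico (mid_le_right q)
      ((Set.Ico_subset_Ico_left (left_le_mid q)).trans (dint_subset hq))]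
  field_simp
  ring

lemma exists_haarCoeff_eq_zero {x : ℝ → ℝ} (hx : x ∈ haarSpan) :
    ∃ N : ℕ, ∀ q, IsDyadic q → N ≤ q.1 → haarCoeff x q = 0 := by
  obtain ⟨N, hN⟩ := exists_eq_of_floor_eq hx
  refine ⟨N, fun q hq hqN => ?_⟩
  have h (t : ℝ) : x t * haarFn q t = x (q.2 / 2 ^ q.1) * haarFn q t := by
    by_cases ht : t ∈ dint q
    · rw [hN q.1 hqN t (q.2 / 2 ^ q.1)]
      rw [floor_eq_of_mem_dint ht, div_mul_cancel₀ _ (by positivity), Int.floor_natCast]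
    · simp [haarFn_eq_zero ht]
  simp only [haarCoeff, ip, h, integral_const_mul, setIntegral_haarFn hq, mul_zero]

lemma finite_isDyadic_lt (N : ℕ) : {q : ℕ × ℕ | IsDyadic q ∧ q.1 < N}.Finite := by
  refine ((Set.finite_Iio N).prod (Set.finite_Iio (2 ^ N))).subset ?_
  rintro q ⟨hq, hN⟩
  exact ⟨hN, hq.trans (Nat.pow_lt_pow_right one_lt_two hN)⟩

/-- A function in the Haar span has finitely many nonzero Haar coefficients. -/
lemma exists_finset_haarCoeff_eq_zero {x : ℝ → ℝ} (hx : x ∈ haarSpan) :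
    ∃ F : Finset Didx, ∀ q, q ∉ F → haarCoeff x q.1 = 0 := by
  obtain ⟨N, hN⟩ := exists_haarCoeff_eq_zero hx
  have hfin : {q : Didx | q.1.1 < N}.Finite :=
    Set.Finite.of_finite_image ((finite_isDyadic_lt N).subset (by
      rintro _ ⟨q, hq, rfl⟩
      exact ⟨q.2, hq⟩)) Subtype.val_injective.injOn
  refine ⟨hfin.toFinset, fun q hq => hN q.1 q.2 ?_⟩
  simpa using hq

lemma le_sqFn {x : ℝ → ℝ} (hx : x ∈ haarSpan) {q : ℕ × ℕ} (hq : IsDyadic q) {t : ℝ}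
    (ht : t ∈ dint q) : |haarCoeff x q| * 2 ^ q.1 ≤ sqFn x t := by
  obtain ⟨F, hF⟩ := exists_finset_haarCoeff_eq_zero hx
  have hs : Summable fun q : Didx =>
      (haarCoeff x q.1 * 2 ^ q.1.1) ^ 2 * (dint q.1).indicator (fun _ => (1 : ℝ)) t :=
    summable_of_ne_finset_zero (s := F) fun q hq => by simp [hF q hq]
  refine Real.le_sqrt_of_sq_le ?_
  refine le_trans (le_of_eq ?_) (hs.le_tsum ⟨q, hq⟩ fun p _ =>
    mul_nonneg (sq_nonneg _) (Set.indicator_nonneg (fun _ _ => zero_le_one) _))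
  simp [ht, mul_pow]

lemma integrableOn_sqFn {x : ℝ → ℝ} (hx : x ∈ haarSpan) :
    IntegrableOn (sqFn x) (Set.Ico 0 1) := by
  obtain ⟨F, hF⟩ := exists_finset_haarCoeff_eq_zero hx
  have hsq : sqFn x = fun t => Real.sqrt (∑ q ∈ F,
      (haarCoeff x q.1 * 2 ^ q.1.1) ^ 2 * (dint q.1).indicator (fun _ => (1 : ℝ)) t) := by
    funext t
    rw [sqFn, tsum_eq_sum fun q hq => by simp [hF q hq]]
  have hmeas : Measurable (sqFn x) := by
    rw [hsq]
    exact (Finset.measurable_fun_sum F fun q _ =>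
      (measurable_const.indicator measurableSet_Ico).const_mul _).sqrt
  refine Measure.integrableOn_of_bounded (by simp) hmeas.aestronglyMeasurable
    (M := Real.sqrt (∑ q ∈ F, (haarCoeff x q.1 * 2 ^ q.1.1) ^ 2)) (.of_forall fun t => ?_)
  rw [hsq, Real.norm_of_nonneg (Real.sqrt_nonneg _)]
  refine Real.sqrt_le_sqrt (Finset.sum_le_sum fun q _ => ?_)
  exact mul_le_of_le_one_right (sq_nonneg _)
    (Set.indicator_apply_le' (fun _ => le_rfl) fun _ => zero_le_one)

/-- Dyadic intervals containing a common point have distinct lengths, so the sum of their inverse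
lengths is controlled by the largest term. -/
lemma sum_inv_len_le_sqFn {x : ℝ → ℝ} (hx : x ∈ haarSpan) {τ : ℝ} (hτ : 0 < τ)
    (G : Finset (ℕ × ℕ)) (hG : ∀ q ∈ G, IsDyadic q ∧ τ ≤ |haarCoeff x q|) (t : ℝ) :
    ∑ q ∈ G, τ * 2 ^ q.1 * (dint q).indicator (fun _ => (1 : ℝ)) t ≤ 2 * sqFn x t := by
  classical
  simp only [Set.indicator_apply, mul_ite, mul_one, mul_zero]
  rw [← Finset.sum_filter, ← Finset.mul_sum]
  set A := G.filter fun q => t ∈ dint q with hA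
  obtain hA0 | hA0 := A.eq_empty_or_nonempty
  · simp [hA0, sqFn, Real.sqrt_nonneg]
  obtain ⟨p, hp, hmax⟩ := A.exists_max_image Prod.fst hA0
  have hinj : Set.InjOn (Prod.fst : ℕ × ℕ → ℕ) A := by
    intro q hq r hr hqr
    have h1 := floor_eq_of_mem_dint (Finset.mem_filter.mp hq).2
    have h2 := floor_eq_of_mem_dint (Finset.mem_filter.mp hr).2
    rw [hqr, h2] at h1
    exact Prod.ext hqr (by exact_mod_cast h1.symm)
  have hsum : ∑ q ∈ A, (2 : ℝ) ^ q.1 ≤ 2 ^ (p.1 + 1) := by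
    rw [← Finset.sum_image (f := fun n => (2 : ℝ) ^ n) hinj]
    have := Nat.geomSum_lt (m := 2) (n := p.1 + 1) (s := A.image Prod.fst) le_rfl (by
      intro k hk
      obtain ⟨q, hq, rfl⟩ := Finset.mem_image.mp hk
      exact Nat.lt_succ_of_le (hmax q hq))
    exact_mod_cast this.le
  obtain ⟨hpG, hpt⟩ := Finset.mem_filter.mp hp
  calc τ * ∑ q ∈ A, (2 : ℝ) ^ q.1 ≤ τ * 2 ^ (p.1 + 1) := by gcongr
    _ = 2 * (τ * 2 ^ p.1) := by ring
    _ ≤ 2 * (|haarCoeff x p| * 2 ^ p.1) := by gcongr; exact (hG p hpG).2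
    _ ≤ 2 * sqFn x t := by gcongr; exact le_sqFn hx (hG p hpG).1 hpt

lemma setIntegral_indicator_dint {q : ℕ × ℕ} (hq : IsDyadic q) :
    ∫ t in Set.Ico (0 : ℝ) 1, (dint q).indicator (fun _ => (1 : ℝ)) t = (2 ^ q.1)⁻¹ := by
  rw [dint, setIntegral_indicator_Ico ((left_le_mid q).trans (mid_le_right q)) (dint_subset hq)]
  ring

lemma card_mul_le_two_mul_H1norm {x : ℝ → ℝ} (hx : x ∈ haarSpan) {τ : ℝ} (hτ : 0 < τ)
    (G : Finset (ℕ × ℕ)) (hG : ∀ q ∈ G, IsDyadic q ∧ τ ≤ |haarCoeff x q|) :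
    (G.card : ℝ) * τ ≤ 2 * H1norm x := by
  have hint : ∀ q ∈ G, IntegrableOn
      (fun t => τ * 2 ^ q.1 * (dint q).indicator (fun _ => (1 : ℝ)) t) (Set.Ico 0 1) :=
    fun q _ => (integrableOn_indicator_Ico _ _).const_mul _
  calc (G.card : ℝ) * τ
      = ∫ t in Set.Ico (0 : ℝ) 1,
          ∑ q ∈ G, τ * 2 ^ q.1 * (dint q).indicator (fun _ => (1 : ℝ)) t := by
        rw [integral_finsetSum _ hint, ← nsmul_eq_mul, ← Finset.sum_const]
        refine Finset.sum_congr rfl fun q hq => ?_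
        rw [integral_const_mul, setIntegral_indicator_dint (hG q hq).1]
        field_simp
    _ ≤ ∫ t in Set.Ico (0 : ℝ) 1, 2 * sqFn x t :=
        integral_mono (integrable_finsetSum _ hint) ((integrableOn_sqFn hx).const_mul 2)
          (sum_inv_len_le_sqFn hx hτ G hG)
    _ = 2 * H1norm x := integral_const_mul _ _

end DyadicH

/-- For every `τ > 0` and every `x` in the span of the Haar system, the set of dyadic
intervals `J` with `|⟨x, h_J⟩| ≥ τ` is finite, of cardinality at most `16 τ⁻² ‖x‖²_{H¹}`. -/
theorem card_large_haar_coeff_le (τ : ℝ) (hτ : 0 < τ) (x : ℝ → ℝ) (hx : x ∈ DyadicH.haarSpan) :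
    {q : ℕ × ℕ | DyadicH.IsDyadic q ∧ τ ≤ |DyadicH.haarCoeff x q|}.Finite ∧
    ({q : ℕ × ℕ | DyadicH.IsDyadic q ∧ τ ≤ |DyadicH.haarCoeff x q|}.ncard : ℝ) ≤
      16 * τ⁻¹ ^ 2 * DyadicH.H1norm x ^ 2 := by
  have hfin : {q : ℕ × ℕ | DyadicH.IsDyadic q ∧ τ ≤ |DyadicH.haarCoeff x q|}.Finite := by
    obtain ⟨N, hN⟩ := DyadicH.exists_haarCoeff_eq_zero hx
    refine (DyadicH.finite_isDyadic_lt N).subset fun q hq => ⟨hq.1, ?_⟩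
    by_contra! h
    have := hq.2
    rw [hN q hq.1 h, abs_zero] at this
    exact this.not_gt hτ
  refine ⟨hfin, ?_⟩
  rw [Set.ncard_eq_toFinset_card _ hfin]
  have key := DyadicH.card_mul_le_two_mul_H1norm hx hτ hfin.toFinset
    fun q hq => hfin.mem_toFinset.mp hq
  set c := hfin.toFinset.card
  have hc : (c : ℝ) ≤ (c : ℝ) ^ 2 := by exact_mod_cast Nat.le_self_pow two_ne_zero c
  have h1 : (c : ℝ) ≤ 2 * τ⁻¹ * DyadicH.H1norm x := by
    rw [← le_div_iff₀ hτ] at key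
    exact key.trans_eq (by ring)
  have h2 : (c : ℝ) ^ 2 ≤ (2 * τ⁻¹ * DyadicH.H1norm x) ^ 2 := by gcongr
  nlinarith [sq_nonneg (τ⁻¹ * DyadicH.H1norm x)]

end
end

section
/- Let 𝒢 be a nonempty finite collection of dyadic intervals and suppose 𝒢 = 𝒢₁ ∪ 𝒢₂ ∪ … ∪ 𝒢_L. Then there exists ℓ with 1 ≤ ℓ ≤ L such that ⟦𝒢_ℓ⟧ ≥ ⟦𝒢⟧ / L. -/
open MeasureTheory
open scoped ENNReal

noncomputable section

namespace DyadicH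

theorem dint_subset_dint_iff {I J : ℕ × ℕ} :
    dint J ⊆ dint I ↔
      I.2 * 2 ^ J.1 ≤ J.2 * 2 ^ I.1 ∧ (J.2 + 1) * 2 ^ I.1 ≤ (I.2 + 1) * 2 ^ J.1 := by
  have hI : (0 : ℝ) < 2 ^ I.1 := by positivity
  have hJ : (0 : ℝ) < 2 ^ J.1 := by positivity
  have hlt : (J.2 : ℝ) / 2 ^ J.1 < (J.2 + 1 : ℝ) / 2 ^ J.1 := by gcongr; linarith
  rw [dint, dint, Set.Ico_subset_Ico_iff hlt, div_le_div_iff₀ hI hJ, div_le_div_iff₀ hJ hI]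
  norm_cast

/-- A dyadic interval has no dyadic subinterval of larger length. -/
theorem fst_le_of_dint_subset {I J : ℕ × ℕ} (h : dint J ⊆ dint I) : I.1 ≤ J.1 := by
  obtain ⟨h₁, h₂⟩ := dint_subset_dint_iff.1 h
  have : 2 ^ I.1 ≤ 2 ^ J.1 := by linarith
  exact (Nat.pow_le_pow_iff_right one_lt_two).1 this

/-- A dyadic subinterval of `I` is `I` itself or lies in one of the two halves of `I`. -/
theorem eq_or_dint_subset_child {I J : ℕ × ℕ} (h : dint J ⊆ dint I) :
    J = I ∨ dint J ⊆ dint (I.1 + 1, 2 * I.2) ∨ dint J ⊆ dint (I.1 + 1, 2 * I.2 + 1) := by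
  have hle := fst_le_of_dint_subset h
  obtain ⟨n, k⟩ := I
  obtain ⟨m, j⟩ := J
  obtain ⟨d, rfl⟩ := Nat.exists_eq_add_of_le hle
  have hn : 0 < 2 ^ n := by positivity
  simp only [dint_subset_dint_iff] at h ⊢
  obtain ⟨h₁, h₂⟩ := h
  have h₁' : k * 2 ^ d ≤ j := by
    refine Nat.le_of_mul_le_mul_right ?_ hn
    rw [pow_add] at h₁; linarith
  have h₂' : j + 1 ≤ (k + 1) * 2 ^ d := by
    refine Nat.le_of_mul_le_mul_right ?_ hn
    rw [pow_add] at h₂; linarith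
  rcases d with _ | d
  · left
    simp only [pow_zero, mul_one] at h₁' h₂'
    rw [add_zero, show j = k by lia]
  · right
    rw [pow_succ] at h₁' h₂'
    have key : ∀ {a b : ℕ}, a ≤ b → a * (2 ^ n * 2) ≤ b * (2 ^ n * 2) := fun hab =>
      Nat.mul_le_mul_right _ hab
    rcases le_or_gt (j + 1) ((2 * k + 1) * 2 ^ d) with hj | hj
    · left
      have h₃ := key (show 2 * k * 2 ^ d ≤ j by linarith)
      have h₄ := key hj
      simp only [pow_add, pow_one]
      constructor <;> linarith
    · right
      have h₃ := key (show (2 * k + 1) * 2 ^ d ≤ j by lia)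
      have h₄ := key (show j + 1 ≤ (2 * k + 2) * 2 ^ d by linarith)
      simp only [pow_add, pow_one]
      constructor <;> linarith

theorem len_nonneg (q : ℕ × ℕ) : 0 ≤ len q := by
  unfold len; positivity

open scoped Classical in
/-- The total length `∑_{J ∈ E, J ⊆ I} |J|` of the members of `E` contained in `I`. -/
def lenWithin (E : Finset (ℕ × ℕ)) (I : ℕ × ℕ) : ℝ :=
  ∑ J ∈ E, if dint J ⊆ dint I then len J else 0

theorem lenWithin_nonneg (E : Finset (ℕ × ℕ)) (I : ℕ × ℕ) : 0 ≤ lenWithin E I :=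
  Finset.sum_nonneg fun J _ => by split_ifs <;> simp [len_nonneg]

theorem carleson_eq (E : Finset (ℕ × ℕ)) :
    carleson E = ⨆ I ∈ E, (2 : ℝ) ^ I.1 * lenWithin E I := rfl

theorem carleson_nonneg (E : Finset (ℕ × ℕ)) : 0 ≤ carleson E := by
  rw [carleson_eq]
  exact Real.iSup_nonneg fun I => Real.iSup_nonneg fun _ =>
    mul_nonneg (by positivity) (lenWithin_nonneg E I)

theorem carleson_le {E : Finset (ℕ × ℕ)} {C : ℝ} (hC : 0 ≤ C)
    (h : ∀ I ∈ E, (2 : ℝ) ^ I.1 * lenWithin E I ≤ C) : carleson E ≤ C := by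
  rw [carleson_eq]
  exact Real.iSup_le (fun I => Real.iSup_le (h I) hC) hC

theorem le_carleson {E : Finset (ℕ × ℕ)} {I : ℕ × ℕ} (hI : I ∈ E) :
    (2 : ℝ) ^ I.1 * lenWithin E I ≤ carleson E := by
  have hnn : ∀ J, 0 ≤ (2 : ℝ) ^ J.1 * lenWithin E J := fun J =>
    mul_nonneg (by positivity) (lenWithin_nonneg E J)
  rw [carleson_eq]
  refine le_ciSup_of_le ⟨∑ J ∈ E, (2 : ℝ) ^ J.1 * lenWithin E J, ?_⟩ I ?_
  · rintro _ ⟨J, rfl⟩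
    exact Real.iSup_le (fun hJ => Finset.single_le_sum (fun K _ => hnn K) hJ)
      (Finset.sum_nonneg fun K _ => hnn K)
  · rw [ciSup_pos hI]

theorem lenWithin_le_add_of_notMem {E : Finset (ℕ × ℕ)} {I : ℕ × ℕ} (hI : I ∉ E) :
    lenWithin E I ≤ lenWithin E (I.1 + 1, 2 * I.2) + lenWithin E (I.1 + 1, 2 * I.2 + 1) := by
  unfold lenWithin
  rw [← Finset.sum_add_distrib]
  refine Finset.sum_le_sum fun J hJ => ?_
  have := len_nonneg J
  by_cases h : dint J ⊆ dint I
  · rcases eq_or_dint_subset_child h with rfl | h' | h'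
    · exact absurd hJ hI
    all_goals rw [if_pos h, if_pos h']; split_ifs <;> linarith
  · rw [if_neg h]; split_ifs <;> linarith

/-- The Carleson packing condition holds for every dyadic interval, not only for members of the
collection. -/
theorem lenWithin_le_carleson_mul_len (E : Finset (ℕ × ℕ)) (I : ℕ × ℕ) :
    lenWithin E I ≤ carleson E * len I := by
  obtain ⟨N, hN⟩ : ∃ N, ∀ J ∈ E, J.1 < N :=
    ⟨E.sup Prod.fst + 1, fun J hJ => Nat.lt_succ_of_le (Finset.le_sup (f := Prod.fst) hJ)⟩
  induction hd : N - I.1 generalizing I with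
  | zero =>
    have : lenWithin E I = 0 := Finset.sum_eq_zero fun J hJ => if_neg fun h => by
      have := fst_le_of_dint_subset h
      have := hN J hJ
      lia
    rw [this]
    exact mul_nonneg (carleson_nonneg E) (len_nonneg I)
  | succ d ih =>
    by_cases hI : I ∈ E
    · rw [len, ← div_eq_mul_inv, le_div_iff₀' (by positivity)]
      exact le_carleson hI
    · have h₁ := ih (I.1 + 1, 2 * I.2) (by simp only; lia)
      have h₂ := ih (I.1 + 1, 2 * I.2 + 1) (by simp only; lia)
      have hlen : ∀ k, len (I.1 + 1, k) = len I / 2 := fun k => by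
        simp only [len, pow_succ]; field_simp
      rw [hlen] at h₁ h₂
      linarith [lenWithin_le_add_of_notMem hI]

theorem lenWithin_le_sum_of_cover {ι : Type*} [Fintype ι] {G : Finset (ℕ × ℕ)}
    {Gs : ι → Finset (ℕ × ℕ)} (hcover : ∀ q, q ∈ G ↔ ∃ i, q ∈ Gs i) (I : ℕ × ℕ) :
    lenWithin G I ≤ ∑ i, lenWithin (Gs i) I := by
  classical
  unfold lenWithin
  rw [Finset.sum_comm' (t' := G) (s' := fun J => {i | J ∈ Gs i})
    (by simp only [Finset.mem_univ, Finset.mem_filter, true_and, hcover]; tauto)]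
  refine Finset.sum_le_sum fun J hJ => ?_
  obtain ⟨i, hi⟩ := (hcover J).1 hJ
  have hnn : 0 ≤ if dint J ⊆ dint I then len J else 0 := by
    split_ifs <;> simp [len_nonneg]
  exact Finset.single_le_sum (f := fun _ : ι => if dint J ⊆ dint I then len J else 0)
    (fun _ _ => hnn) (by simpa using hi)

/-- The Carleson constant is subadditive under unions. -/
theorem carleson_le_sum_of_cover {ι : Type*} [Fintype ι] {G : Finset (ℕ × ℕ)}
    {Gs : ι → Finset (ℕ × ℕ)} (hcover : ∀ q, q ∈ G ↔ ∃ i, q ∈ Gs i) :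
    carleson G ≤ ∑ i, carleson (Gs i) := by
  refine carleson_le (Finset.sum_nonneg fun i _ => carleson_nonneg _) fun I _ => ?_
  rw [← le_div_iff₀' (by positivity), div_eq_mul_inv, Finset.sum_mul]
  exact (lenWithin_le_sum_of_cover hcover I).trans
    (Finset.sum_le_sum fun i _ => lenWithin_le_carleson_mul_len (Gs i) I)

end DyadicH

/-- If a nonempty finite collection `G` of dyadic intervals is covered by `G = G₁ ∪ … ∪ G_L`,
then some `G_ℓ` has Carleson constant at least `⟦G⟧ / L`. -/
theorem exists_part_with_large_carleson (L : ℕ) (G : Finset (ℕ × ℕ))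
    (Gs : Fin L → Finset (ℕ × ℕ)) (hG : G.Nonempty) (hdy : ∀ q ∈ G, DyadicH.IsDyadic q)
    (hcover : ∀ q : ℕ × ℕ, q ∈ G ↔ ∃ ℓ : Fin L, q ∈ Gs ℓ) :
    ∃ ℓ : Fin L, DyadicH.carleson G / L ≤ DyadicH.carleson (Gs ℓ) := by
  obtain ⟨q, hq⟩ := hG
  obtain ⟨ℓ₀, -⟩ := (hcover q).1 hq
  have hL : (L : ℝ) ≠ 0 := Nat.cast_ne_zero.2 ℓ₀.pos.ne'
  have hsum : ∑ _ℓ : Fin L, DyadicH.carleson G / L ≤ ∑ ℓ, DyadicH.carleson (Gs ℓ) := by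
    rw [Finset.sum_const, Finset.card_univ, Fintype.card_fin, nsmul_eq_mul, mul_div_cancel₀ _ hL]
    exact DyadicH.carleson_le_sum_of_cover hcover
  obtain ⟨ℓ, -, hℓ⟩ := Finset.exists_le_of_sum_le ⟨ℓ₀, Finset.mem_univ ℓ₀⟩ hsum
  exact ⟨ℓ, hℓ⟩

end
end
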